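/- arXiv:2209.02336 — 5 statements merged into one kernel-verified Lean document; each statement's English description precedes it below -/
import Mathlib

section
/- For every real number p ≥ 0 and every integer n ≥ 1, the identity ∑_{m=1}^{n} (−1)^{m−1} · C(n−1, m−1) · (m−1)! · p^{m−1} / ∏_{k=1}^{m}(1+kp) = 1/(1+np) holds, where C(a,b) denotes the binomial coefficient. -/
theorem aux_partial (p : ℝ) (hp : 0 ≤ p) (N M : ℕ) (hM : M ≤ N + 1) :
    (1 + ((N : ℝ) + 1) * p) * ∑ j ∈ Finset.range M,
      ((-1 : ℝ) ^ j * (Nat.choose N j : ℝ) * (Nat.factorial j : ℝ) * p ^ j /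
          ∏ k ∈ Finset.Icc 1 (j + 1), (1 + (k : ℝ) * p))
      = 1 - (-1 : ℝ) ^ M * (Nat.descFactorial N M : ℝ) * p ^ M /
          ∏ k ∈ Finset.Icc 1 M, (1 + (k : ℝ) * p) := by
  induction M with
  | zero => simp
  | succ M ih =>
    have hMN : M ≤ N := by omega
    rw [Finset.sum_range_succ, mul_add, ih (by omega), Finset.prod_Icc_succ_top (by omega),
      Nat.descFactorial_succ, Nat.descFactorial_eq_factorial_mul_choose]
    have h1 : (∏ k ∈ Finset.Icc 1 M, (1 + (k : ℝ) * p)) ≠ 0 :=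
      Finset.prod_ne_zero_iff.2 fun k _ => by positivity
    have h2 : (1 + ((M : ℝ) + 1) * p) ≠ 0 := by positivity
    generalize (∏ k ∈ Finset.Icc 1 M, (1 + (k : ℝ) * p)) = P at h1 ⊢
    push_cast [Nat.cast_sub hMN]
    field_simp
    ring

/-- For every real `p ≥ 0` and every integer `n ≥ 1`,
`∑_{m=1}^{n} (−1)^{m−1} · C(n−1, m−1) · (m−1)! · p^{m−1} / ∏_{k=1}^{m}(1+kp) = 1/(1+np)`. -/
theorem rank_supplanting_beta_identity (p : ℝ) (hp : 0 ≤ p) (n : ℕ) (hn : 1 ≤ n) :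
    ∑ m ∈ Finset.Icc 1 n,
      ((-1 : ℝ) ^ (m - 1) * (Nat.choose (n - 1) (m - 1) : ℝ) *
        (Nat.factorial (m - 1) : ℝ) * p ^ (m - 1) /
          ∏ k ∈ Finset.Icc 1 m, (1 + (k : ℝ) * p))
      = 1 / (1 + (n : ℝ) * p) := by
  obtain ⟨N, rfl⟩ : ∃ N, n = N + 1 := ⟨n - 1, by omega⟩
  have h := aux_partial p hp N (N + 1) le_rfl
  rw [Nat.descFactorial_of_lt (Nat.lt_succ_self N)] at h
  have h2 : (1 + ((N : ℝ) + 1) * p) ≠ 0 := by positivity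
  rw [← Finset.Ico_add_one_right_eq_Icc, Finset.sum_Ico_eq_sum_range]
  push_cast
  rw [eq_div_iff h2, mul_comm]
  simpa [add_comm 1] using h
end

section
/- For every supplanting rate p > 0, the full transition matrix T breaks permutation symmetry: for every permutation σ ∈ S_N with σ ≠ id, there exist configurations x, y such that ⟨σ·y|T|σ·x⟩ ≠ ⟨y|T|x⟩, where (σ·x)_i := x_{σ⁻¹(i)}. -/
open Finset

/-- The unit displacement on `ℤ/Lℤ` in direction `d` (`true` = `+`, `false` = `−`). -/
def step (L : ℕ) (d : Bool) : ZMod L := if d then 1 else -1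

/-- The hopping map `f_i^d` on configurations: agent `i` hops one site in direction `d`. -/
def hop {N L : ℕ} (x : Fin N → ZMod L) (i : Fin N) (d : Bool) : Fin N → ZMod L :=
  Function.update x i (x i + step L d)

/-- The equilibrium hopping rate `c_β(x,i,d) = 1/(2N(1+exp(β(E(f_i^d x) − E(x)))))`. -/
noncomputable def cb {N L : ℕ} (E : (Fin N → ZMod L) → ℝ) (β : ℝ)
    (x : Fin N → ZMod L) (i : Fin N) (d : Bool) : ℝ :=
  1 / (2 * (N : ℝ) * (1 + Real.exp (β * (E (hop x i d) - E x))))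

/-- Entry `⟨y|T₀|x⟩` of the equilibrium transition matrix. -/
noncomputable def T0 {N L : ℕ} (E : (Fin N → ZMod L) → ℝ) (β : ℝ)
    (y x : Fin N → ZMod L) : ℝ :=
  (∑ i : Fin N, ∑ d : Bool, cb E β x i d * (if y = hop x i d then 1 else 0))
    + (1 - ∑ i : Fin N, ∑ d : Bool, cb E β x i d) * (if y = x then 1 else 0)

/-- The set `S(x,i,d)` of agents of rank lower than `i` sitting at site `x_i ± 1`. -/
def Sset {N L : ℕ} (x : Fin N → ZMod L) (i : Fin N) (d : Bool) : Finset (Fin N) :=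
  Finset.univ.filter (fun j => i < j ∧ x j = x i + step L d)

/-- `n(x,i,d) = #S(x,i,d)`. -/
def nS {N L : ℕ} (x : Fin N → ZMod L) (i : Fin N) (d : Bool) : ℕ := (Sset x i d).card

/-- Entry `⟨y|T|x⟩` of the full transition matrix with supplanting rate `p`. -/
noncomputable def Tfull {N L : ℕ} (E : (Fin N → ZMod L) → ℝ) (β p : ℝ)
    (y x : Fin N → ZMod L) : ℝ :=
  (∑ i : Fin N, ∑ d : Bool,
      (cb E β x i d / (1 + p * (nS x i d : ℝ)) * (if y = hop x i d then 1 else 0)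
        + ∑ j ∈ Sset x i d, ∑ d' : Bool,
            p * cb E β x i d / (2 * (1 + p * (nS x i d : ℝ))) *
              (if y = hop (hop x i d) j d' then 1 else 0)))
    + (1 - ∑ i : Fin N, ∑ d : Bool, cb E β x i d) * (if y = x then 1 else 0)

/-- Entry `⟨y|T_n|x⟩` of the `n`-th term of the supplanting decomposition. -/
noncomputable def Tterm {N L : ℕ} (E : (Fin N → ZMod L) → ℝ) (β p : ℝ) (n : ℕ)
    (y x : Fin N → ZMod L) : ℝ :=
  ∑ i : Fin N, ∑ d : Bool,
    if nS x i d = n then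
      p * cb E β x i d / (2 * (1 + (n : ℝ) * p)) *
        ∑ j ∈ Sset x i d, ∑ d' : Bool,
          ((if y = hop (hop x i d) j d' then (1 : ℝ) else 0)
            - (if y = hop x i d then 1 else 0))
    else 0

/-- The action of a permutation `σ` on configurations: `(σ·x)_i = x_{σ⁻¹(i)}`. -/
def permAct {N L : ℕ} (σ : Equiv.Perm (Fin N)) (x : Fin N → ZMod L) : Fin N → ZMod L :=
  fun i => x (σ⁻¹ i)


lemma cb_pos' {N L : ℕ} (hN : 2 ≤ N) (E : (Fin N → ZMod L) → ℝ) (β : ℝ)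
    (x : Fin N → ZMod L) (i : Fin N) (d : Bool) : 0 < cb E β x i d := by
  have : (0 : ℝ) < N := by exact_mod_cast (by omega : 0 < N)
  unfold cb
  positivity

lemma Tfull_pos' {N L : ℕ} (hN : 2 ≤ N) (E : (Fin N → ZMod L) → ℝ) (β p : ℝ) (hp : 0 < p)
    (x y : Fin N → ZMod L) (hxy : y ≠ x) (a b : Fin N) (d d' : Bool) (hb : b ∈ Sset x a d)
    (hy : y = hop (hop x a d) b d') : 0 < Tfull E β p y x := by
  have hc := cb_pos' hN E β x
  have h1 : ∀ i d j d', 0 ≤ p * cb E β x i d / (2 * (1 + p * (nS x i d : ℝ))) *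
              (if y = hop (hop x i d) j d' then (1 : ℝ) else 0) := by
    intro i d j d'
    have := hc i d
    split_ifs <;> positivity
  have h2 : ∀ i d, 0 ≤ cb E β x i d / (1 + p * (nS x i d : ℝ)) *
      (if y = hop x i d then (1 : ℝ) else 0) := by
    intro i d
    have := hc i d
    split_ifs <;> positivity
  have h3 : ∀ i d, 0 ≤ ∑ j ∈ Sset x i d, ∑ d' : Bool,
            p * cb E β x i d / (2 * (1 + p * (nS x i d : ℝ))) *
              (if y = hop (hop x i d) j d' then (1 : ℝ) else 0) := fun i d =>
    Finset.sum_nonneg fun j _ => Finset.sum_nonneg fun d' _ => h1 i d j d'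
  unfold Tfull
  rw [if_neg hxy, mul_zero, add_zero]
  refine Finset.sum_pos' (fun i _ => Finset.sum_nonneg fun d _ => add_nonneg (h2 i d) (h3 i d))
    ⟨a, Finset.mem_univ _, ?_⟩
  refine Finset.sum_pos' (fun d _ => add_nonneg (h2 a d) (h3 a d)) ⟨d, Finset.mem_univ _, ?_⟩
  refine add_pos_of_nonneg_of_pos (h2 a d) ?_
  refine Finset.sum_pos' (fun j _ => Finset.sum_nonneg fun d' _ => h1 a d j d') ⟨b, hb, ?_⟩
  refine Finset.sum_pos' (fun d' _ => h1 a d b d') ⟨d', Finset.mem_univ _, ?_⟩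
  rw [if_pos hy]
  have := hc a d
  positivity

lemma Tfull_zero' {N L : ℕ} (E : (Fin N → ZMod L) → ℝ) (β p : ℝ)
    (x y : Fin N → ZMod L) (h0 : y ≠ x) (h1 : ∀ i d, y ≠ hop x i d)
    (h2 : ∀ i d, ∀ j ∈ Sset x i d, ∀ d', y ≠ hop (hop x i d) j d') : Tfull E β p y x = 0 := by
  unfold Tfull
  rw [if_neg h0, mul_zero, add_zero]
  refine Finset.sum_eq_zero fun i _ => Finset.sum_eq_zero fun d _ => ?_
  rw [if_neg (h1 i d), mul_zero, zero_add]
  refine Finset.sum_eq_zero fun j hj => Finset.sum_eq_zero fun d' _ => ?_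
  rw [if_neg (h2 i d j hj d'), mul_zero]

lemma hop_ne' {N L : ℕ} (x : Fin N → ZMod L) (i k : Fin N) (d : Bool) (h : k ≠ i) :
    hop x i d k = x k := by
  simp [hop, h]

lemma hop_self' {N L : ℕ} (x : Fin N → ZMod L) (i : Fin N) (d : Bool) :
    hop x i d i = x i + step L d := by
  simp [hop]

lemma exists_inv' {N : ℕ} (σ : Equiv.Perm (Fin N)) (hσ : σ ≠ 1) :
    ∃ a b, a < b ∧ σ b < σ a := by
  by_contra! h
  apply hσ
  have hm : StrictMono σ := fun a b hab =>
    lt_of_le_of_ne (h a b hab) (fun e => hab.ne (σ.injective e))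
  ext i
  have : (σ : Fin N → Fin N) = id := by
    have h1 := Subsingleton.elim (hm.orderIsoOfSurjective _ σ.surjective) (OrderIso.refl _)
    funext i
    exact congrArg (fun e : Fin N ≃o Fin N => e i) h1
  simp [this]

/-- For every supplanting rate `p > 0`, the full transition matrix breaks
permutation symmetry: for every `σ ≠ id` there are configurations `x, y` with
`⟨σ·y|T|σ·x⟩ ≠ ⟨y|T|x⟩`. -/
theorem rank_supplanting_T_breaks_perm_symmetry (N L : ℕ) (hN : 2 ≤ N) (hL : 3 ≤ L)
    (E : (Fin N → ZMod L) → ℝ)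
    (hE : ∀ (σ : Equiv.Perm (Fin N)) (x : Fin N → ZMod L), E (x ∘ σ) = E x)
    (β p : ℝ) (hp : 0 < p) (σ : Equiv.Perm (Fin N)) (hσ : σ ≠ 1) :
    ∃ x y : Fin N → ZMod L,
      Tfull E β p (permAct σ y) (permAct σ x) ≠ Tfull E β p y x := by
  have t20 : (2 : ZMod L) ≠ 0 := by
    intro h
    have h' : ((2 : ℕ) : ZMod L) = 0 := by exact_mod_cast h
    rw [ZMod.natCast_eq_zero_iff] at h'
    have := Nat.le_of_dvd (by norm_num) h'
    omega
  have t10 : (1 : ZMod L) ≠ 0 := by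
    intro h
    apply t20
    linear_combination 2 * h
  obtain ⟨a, b, hab, hs⟩ := exists_inv' σ hσ
  let x : Fin N → ZMod L := Pi.single b 1
  have xa : x a = 0 := by simp [x, hab.ne]
  have xb : x b = 1 := by simp [x]
  let y := hop (hop x a true) b true
  have ya : y a = 1 := by
    simp only [y]
    rw [hop_ne' _ _ _ _ hab.ne, hop_self', xa]
    simp [step]
  have yb : y b = 2 := by
    simp only [y]
    rw [hop_self', hop_ne' _ _ _ _ hab.ne', xb]
    simp only [step, if_true]
    norm_num
  refine ⟨x, y, ?_⟩
  have hpos : 0 < Tfull E β p y x := by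
    refine Tfull_pos' hN E β p hp x y ?_ a b true true ?_ rfl
    · intro h
      rw [h, xa] at ya
      exact t10 ya.symm
    · simp [Sset, hab, xa, xb, step]
  have hzero : Tfull E β p (permAct σ y) (permAct σ x) = 0 := by
    have ua : permAct σ x (σ a) = 0 := by simp [permAct, xa]
    have ub : permAct σ x (σ b) = 1 := by simp [permAct, xb]
    have va : permAct σ y (σ a) = 1 := by simp [permAct, ya]
    have vb : permAct σ y (σ b) = 2 := by simp [permAct, yb]
    generalize permAct σ x = u at *
    generalize permAct σ y = v at *
    have t21 : (2 : ZMod L) ≠ 1 := by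
      intro h
      apply t10
      linear_combination h
    apply Tfull_zero'
    · rintro rfl
      exact t10 (va.symm.trans ua)
    · rintro i d rfl
      by_cases h : σ a = i
      · rw [hop_ne' _ _ _ _ (h ▸ hs.ne), ub] at vb
        exact t21 vb.symm
      · rw [hop_ne' _ _ _ _ h, ua] at va
        exact t10 va.symm
    · rintro i d j hj d' rfl
      simp only [Sset, Finset.mem_filter, Finset.mem_univ, true_and] at hj
      obtain ⟨hij, hu⟩ := hj
      have hA : σ a = j ∨ σ a = i := by
        by_contra! h
        rw [hop_ne' _ _ _ _ h.1, hop_ne' _ _ _ _ h.2, ua] at va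
        exact t10 va.symm
      have hB : σ b = j ∨ σ b = i := by
        by_contra! h
        rw [hop_ne' _ _ _ _ h.1, hop_ne' _ _ _ _ h.2, ub] at vb
        exact t21 vb.symm
      have hbi : σ b = i := by
        rcases hB with h | h
        · rcases hA with h' | h' <;> omega
        · exact h
      have haj : σ a = j := by
        rcases hA with h' | h'
        · exact h'
        · omega
      subst hbi haj
      rw [hop_ne' _ _ _ _ hs.ne, hop_self', ← hu, ua] at vb
      exact t20 vb.symm
  rw [hzero]
  exact hpos.ne
end

section
/- For every p ≥ 0, every 1 ≤ n ≤ N−1, and all configurations x, y, the entries of the n-th term of the supplanting decomposition satisfy |⟨y|T_n|x⟩| ≤ p/2; more precisely, |⟨y|T_n|x⟩| ≤ n·p/(2N(1+np)). -/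
open Finset

noncomputable def Tpiece {N L : ℕ} (E : (Fin N → ZMod L) → ℝ) (β p : ℝ) (n : ℕ)
    (y x : Fin N → ZMod L) (i : Fin N) (d : Bool) : ℝ :=
    if nS x i d = n then
      p * cb E β x i d / (2 * (1 + (n : ℝ) * p)) *
        ∑ j ∈ Sset x i d, ∑ d' : Bool,
          ((if y = hop (hop x i d) j d' then (1 : ℝ) else 0)
            - (if y = hop x i d then 1 else 0))
    else 0

theorem step_ne_zero' {L : ℕ} (hL : 3 ≤ L) (d : Bool) : step L d ≠ 0 := by
  have : Fact (1 < L) := ⟨by omega⟩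
  cases d <;> simp [step]

theorem step_inj' {L : ℕ} (hL : 3 ≤ L) (d e : Bool) (h : step L d = step L e) : d = e := by
  have : Fact (2 < L) := ⟨by omega⟩
  have h2 := ZMod.neg_one_ne_one (n := L)
  cases d <;> cases e <;> simp [step] at h ⊢
  · exact h2 h
  · exact h2 h.symm

theorem Tpiece_key {N L : ℕ} (E : (Fin N → ZMod L) → ℝ) (β p : ℝ) (n : ℕ)
    (y x : Fin N → ZMod L) (i : Fin N) (d : Bool) (h : Tpiece E β p n y x i d ≠ 0) :
    (∀ k < i, y k = x k) ∧ y i = x i + step L d := by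
  by_contra hc
  apply h
  unfold Tpiece
  by_cases hn : nS x i d = n
  · rw [if_pos hn]
    rw [Finset.sum_eq_zero, mul_zero]
    intro j hj
    have hij : i < j := by
      simp only [Sset, Finset.mem_filter] at hj
      exact hj.2.1
    apply Finset.sum_eq_zero
    intro d' _
    have h1 : y ≠ hop x i d := by
      rintro rfl
      apply hc
      refine ⟨fun k hk => ?_, ?_⟩
      · simp [hop, hk.ne]
      · simp [hop]
    have h2 : y ≠ hop (hop x i d) j d' := by
      rintro rfl
      apply hc
      refine ⟨fun k hk => ?_, ?_⟩
      · simp [hop, hk.ne, (hk.trans hij).ne]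
      · simp [hop, hij.ne]
    simp [h1, h2]
  · rw [if_neg hn]

theorem Tpiece_bound {N L : ℕ} (hN : 2 ≤ N) (E : (Fin N → ZMod L) → ℝ) (β p : ℝ) (hp : 0 ≤ p)
    (n : ℕ) (y x : Fin N → ZMod L) (i : Fin N) (d : Bool) :
    |Tpiece E β p n y x i d| ≤ (n : ℝ) * p / (2 * (N : ℝ) * (1 + (n : ℝ) * p)) := by
  have hNpos : (0 : ℝ) < N := by exact_mod_cast (by omega : 0 < N)
  have hD : 0 < 1 + (n : ℝ) * p := by positivity
  unfold Tpiece
  by_cases hn : nS x i d = n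
  · rw [if_pos hn]
    have hc0 : 0 ≤ cb E β x i d := by unfold cb; positivity
    have hc1 : cb E β x i d ≤ 1 / (2 * N) := by
      unfold cb
      apply one_div_le_one_div_of_le (by positivity)
      have := Real.exp_pos (β * (E (hop x i d) - E x))
      nlinarith
    have hs : |∑ j ∈ Sset x i d, ∑ d' : Bool,
          ((if y = hop (hop x i d) j d' then (1 : ℝ) else 0)
            - (if y = hop x i d then 1 else 0))| ≤ n * 2 := by
      calc _ ≤ ∑ j ∈ Sset x i d, (2 : ℝ) := by
            refine (Finset.abs_sum_le_sum_abs _ _).trans (Finset.sum_le_sum fun j _ => ?_)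
            refine (Finset.abs_sum_le_sum_abs _ _).trans ?_
            calc _ ≤ ∑ d' : Bool, (1 : ℝ) := by
                  refine Finset.sum_le_sum fun d' _ => ?_
                  split_ifs <;> norm_num
              _ = 2 := by simp
        _ = n * 2 := by simp [← hn, nS]
    rw [abs_mul, abs_of_nonneg (by positivity)]
    calc _ ≤ p * (1 / (2 * N)) / (2 * (1 + (n : ℝ) * p)) * (n * 2) := by gcongr
      _ = _ := by field_simp
  · rw [if_neg hn, abs_zero]; positivity

/-- Entrywise bounds for the `n`-th term of the supplanting decomposition:
`|⟨y|T_n|x⟩| ≤ n·p/(2N(1+np))`, and in particular `|⟨y|T_n|x⟩| ≤ p/2`. -/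
theorem rank_supplanting_Tn_bound (N L : ℕ) (hN : 2 ≤ N) (hL : 3 ≤ L)
    (E : (Fin N → ZMod L) → ℝ)
    (hE : ∀ (σ : Equiv.Perm (Fin N)) (x : Fin N → ZMod L), E (x ∘ σ) = E x)
    (β p : ℝ) (hp : 0 ≤ p) (n : ℕ) (hn1 : 1 ≤ n) (hn2 : n ≤ N - 1)
    (x y : Fin N → ZMod L) :
    |Tterm E β p n y x| ≤ (n : ℝ) * p / (2 * (N : ℝ) * (1 + (n : ℝ) * p))
    ∧ |Tterm E β p n y x| ≤ p / 2 := by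
  have hNpos : (0 : ℝ) < N := by exact_mod_cast (by omega : 0 < N)
  have hnN : (n : ℝ) ≤ N := by exact_mod_cast (by omega : n ≤ N)
  have hD : 0 < 1 + (n : ℝ) * p := by positivity
  have key : |Tterm E β p n y x| ≤ (n : ℝ) * p / (2 * (N : ℝ) * (1 + (n : ℝ) * p)) := by
    have e : Tterm E β p n y x = ∑ q : Fin N × Bool, Tpiece E β p n y x q.1 q.2 := by
      rw [Fintype.sum_prod_type]
      rfl
    rw [e]
    by_cases hex : ∃ q : Fin N × Bool, Tpiece E β p n y x q.1 q.2 ≠ 0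
    · obtain ⟨q, hq⟩ := hex
      rw [Finset.sum_eq_single q]
      · exact Tpiece_bound hN E β p hp n y x q.1 q.2
      · intro r _ hr
        by_contra hr0
        obtain ⟨a1, a2⟩ := Tpiece_key E β p n y x _ _ hq
        obtain ⟨b1, b2⟩ := Tpiece_key E β p n y x _ _ hr0
        apply hr
        have hi : r.1 = q.1 := by
          rcases lt_trichotomy r.1 q.1 with h | h | h
          · have := a1 _ h
            rw [b2] at this
            exact absurd (by simpa using this) (step_ne_zero' hL r.2)
          · exact h
          · have := b1 _ h
            rw [a2] at this
            exact absurd (by simpa using this) (step_ne_zero' hL q.2)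
        refine Prod.ext hi (step_inj' hL _ _ ?_)
        rw [hi, a2] at b2
        exact (add_left_cancel b2).symm
      · simp
    · push Not at hex
      rw [Finset.sum_eq_zero fun q _ => hex q, abs_zero]
      positivity
  refine ⟨key, key.trans ?_⟩
  rw [div_le_div_iff₀ (by positivity) (by norm_num)]
  have h1 : (n : ℝ) * p ≤ N * p := by gcongr
  have h2 : 0 ≤ p * (N * (n * p)) := by positivity
  nlinarith
end

section
/- The beta decomposition holds: for every p ≥ 0, the full transition matrix decomposes as T = T₀ + U₁ + U₂ + ⋯ + U_{N−1}, i.e. ⟨y|T|x⟩ = ⟨y|T₀|x⟩ + ∑_{m=1}^{N−1} ⟨y|U_m|x⟩ for all configurations x, y. -/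
open Finset

/-- Entry `⟨y|U_m|x⟩` of the `m`-th beta term:
`U_m = ((−1)^{m−1}(m−1)! p^{m−1}/∏_{k=1}^m (1+kp)) ∑_{n=m}^{N−1} C(n−1,m−1)(1+np) T_n`. -/
noncomputable def Uterm {N L : ℕ} (E : (Fin N → ZMod L) → ℝ) (β p : ℝ) (m : ℕ)
    (y x : Fin N → ZMod L) : ℝ :=
  ((-1 : ℝ) ^ (m - 1) * (Nat.factorial (m - 1) : ℝ) * p ^ (m - 1) /
      ∏ k ∈ Finset.Icc 1 m, (1 + (k : ℝ) * p)) *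
    ∑ n ∈ Finset.Icc m (N - 1),
      (Nat.choose (n - 1) (m - 1) : ℝ) * (1 + (n : ℝ) * p) * Tterm E β p n y x

theorem aux_fwd (p : ℝ) (hp : 0 ≤ p) (k : ℕ) : ∀ y : ℕ,
    (fwdDiff 1)^[k] (fun t : ℕ => 1 / (1 + ((t : ℝ) + 1) * p)) y
      = (-1 : ℝ) ^ k * (Nat.factorial k : ℝ) * p ^ k /
        ∏ j ∈ Finset.range (k + 1), (1 + ((y : ℝ) + j + 1) * p) := by
  induction k with
  | zero => intro y; simp
  | succ k ih =>
    intro y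
    rw [Function.iterate_succ_apply', fwdDiff, ih, ih]
    have e1 : ∏ j ∈ Finset.range (k + 1), (1 + (((y + 1 : ℕ) : ℝ) + j + 1) * p)
        = (∏ j ∈ Finset.range k, (1 + ((y : ℝ) + (j + 1 : ℕ) + 1) * p))
          * (1 + ((y : ℝ) + k + 2) * p) := by
      rw [Finset.prod_range_succ]
      congr 1
      · apply Finset.prod_congr rfl
        intro j _
        push_cast; ring
      · push_cast; ring
    rw [e1, Finset.prod_range_succ' _ (k + 1), Finset.prod_range_succ' _ k,
      Finset.prod_range_succ _ k]
    have hP : 0 < ∏ j ∈ Finset.range k, (1 + ((y : ℝ) + (j + 1 : ℕ) + 1) * p) := by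
      apply Finset.prod_pos
      intro j _
      positivity
    generalize (∏ j ∈ Finset.range k, (1 + ((y : ℝ) + (j + 1 : ℕ) + 1) * p)) = P at hP
    have h1 : 0 < 1 + ((y : ℝ) + k + 2) * p := by positivity
    have h2 : 0 < 1 + ((y : ℝ) + (0 : ℕ) + 1) * p := by positivity
    have h3 : (1 + ((y : ℝ) + (k + 1 : ℕ) + 1) * p) = 1 + ((y : ℝ) + k + 2) * p := by
      push_cast; ring
    rw [h3, Nat.factorial_succ, pow_succ, pow_succ]
    have h1' := h1.ne'
    have h2' := h2.ne'
    have hP' := hP.ne'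
    rw [div_sub_div _ _ (by positivity) (by positivity), div_eq_div_iff (by positivity) (by positivity)]
    push_cast
    ring

theorem aux_sum (p : ℝ) (hp : 0 ≤ p) (n : ℕ) (hn : 1 ≤ n) :
    ∑ m ∈ Finset.Icc 1 n, ((-1 : ℝ) ^ (m - 1) * (Nat.factorial (m - 1) : ℝ) * p ^ (m - 1) /
      ∏ k ∈ Finset.Icc 1 m, (1 + (k : ℝ) * p)) * ((Nat.choose (n - 1) (m - 1) : ℝ)
        * (1 + (n : ℝ) * p)) = 1 := by
  obtain ⟨n, rfl⟩ : ∃ k, n = k + 1 := ⟨n - 1, by omega⟩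
  have h := shift_eq_sum_fwdDiff_iter 1 (fun t : ℕ => 1 / (1 + ((t : ℝ) + 1) * p)) n 0
  simp only [aux_fwd p hp] at h
  have hpos : 0 < 1 + ((n : ℝ) + 1) * p := by positivity
  rw [← Finset.Ico_add_one_right_eq_Icc, Finset.sum_Ico_eq_sum_range]
  have : ∀ m : ℕ, ∏ k ∈ Finset.Icc 1 (1 + m), (1 + (k : ℝ) * p)
      = ∏ j ∈ Finset.range (m + 1), (1 + (((0 : ℕ) : ℝ) + j + 1) * p) := by
    intro m
    rw [← Finset.Ico_add_one_right_eq_Icc, Finset.prod_Ico_eq_prod_range]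
    apply Finset.prod_congr
    · congr 1; omega
    · intro j _
      push_cast; ring
  simp only [this, Nat.add_sub_cancel_left, Nat.add_sub_cancel]
  simp only [← mul_assoc]
  rw [← Finset.sum_mul]
  have h' : (1 : ℝ) / (1 + ((n : ℝ) + 1) * p) * (1 + ((n : ℝ) + 1) * p) = 1 := by
    field_simp
  have h0 : ((0 + n • 1 : ℕ) : ℝ) = n := by simp
  rw [h0] at h
  rw [h] at h'
  push_cast at h' ⊢
  refine Eq.trans ?_ h'
  congr 1
  apply Finset.sum_congr rfl
  intro j _
  simp
  ring

theorem aux_U {N L : ℕ} (E : (Fin N → ZMod L) → ℝ) (β p : ℝ) (hp : 0 ≤ p)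
    (y x : Fin N → ZMod L) :
    ∑ m ∈ Finset.Icc 1 (N - 1), Uterm E β p m y x
      = ∑ n ∈ Finset.Icc 1 (N - 1), Tterm E β p n y x := by
  simp only [Uterm, Finset.mul_sum]
  rw [Finset.sum_comm' (t' := Finset.Icc 1 (N - 1)) (s' := fun n => Finset.Icc 1 n)]
  · apply Finset.sum_congr rfl
    intro n hn
    have := aux_sum p hp n (Finset.mem_Icc.1 hn).1
    simp only [← mul_assoc] at this ⊢
    rw [← Finset.sum_mul, this, one_mul]
  · intro a b
    simp only [Finset.mem_Icc]
    omega

theorem aux_nS {N L : ℕ} (x : Fin N → ZMod L) (i : Fin N) (d : Bool) : nS x i d ≤ N - 1 := by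
  have : Sset x i d ⊆ Finset.univ.erase i := by
    intro j hj
    simp only [Sset, Finset.mem_filter] at hj
    simp [hj.2.1.ne']
  have h := Finset.card_le_card this
  simpa [nS] using h

theorem aux_T {N L : ℕ} (E : (Fin N → ZMod L) → ℝ) (β p : ℝ) (hp : 0 ≤ p)
    (y x : Fin N → ZMod L) :
    Tfull E β p y x = T0 E β y x + ∑ n ∈ Finset.Icc 1 (N - 1), Tterm E β p n y x := by
  simp only [Tterm]
  rw [Finset.sum_comm]
  simp only [Tfull, T0]
  rw [add_right_comm, ← Finset.sum_add_distrib]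
  congr 1
  apply Finset.sum_congr rfl
  intro i _
  rw [Finset.sum_comm, ← Finset.sum_add_distrib]
  apply Finset.sum_congr rfl
  intro d _
  rw [Finset.sum_ite_eq]
  have hpos : 0 < 1 + p * (nS x i d : ℝ) := by positivity
  have hpos' : 0 < 1 + (nS x i d : ℝ) * p := by positivity
  by_cases h1 : nS x i d ∈ Finset.Icc 1 (N - 1)
  · rw [if_pos h1]
    have hc : ((Sset x i d).card : ℝ) = (nS x i d : ℝ) := rfl
    simp only [← Finset.mul_sum, Finset.sum_sub_distrib, Finset.sum_const,
      nsmul_eq_mul, Finset.card_univ, Fintype.card_bool, hc]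
    generalize (∑ j ∈ Sset x i d, ∑ d' : Bool,
      (if y = hop (hop x i d) j d' then (1 : ℝ) else 0)) = A
    generalize (if y = hop x i d then (1 : ℝ) else 0) = B
    rw [mul_comm (nS x i d : ℝ) p]
    field_simp
    push_cast
    ring
  · rw [if_neg h1]
    have h0 : nS x i d = 0 := by
      have := aux_nS x i d
      simp only [Finset.mem_Icc] at h1
      omega
    have hS : Sset x i d = ∅ := Finset.card_eq_zero.1 h0
    simp [hS, h0]

/-- The beta decomposition `T = T₀ + U₁ + ⋯ + U_{N−1}` holds entrywise. -/
theorem rank_supplanting_beta_decomposition (N L : ℕ) (hN : 2 ≤ N) (hL : 3 ≤ L)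
    (E : (Fin N → ZMod L) → ℝ)
    (hE : ∀ (σ : Equiv.Perm (Fin N)) (x : Fin N → ZMod L), E (x ∘ σ) = E x)
    (β p : ℝ) (hp : 0 ≤ p) (x y : Fin N → ZMod L) :
    Tfull E β p y x = T0 E β y x + ∑ m ∈ Finset.Icc 1 (N - 1), Uterm E β p m y x := by
  rw [aux_U E β p hp, aux_T E β p hp]
end

section
/- For every p ≥ 0 and every subset A ⊆ {1, …, N−1}, the matrix M := T₀ + ∑_{n∈A} T_n is a stochastic matrix: all entries ⟨y|M|x⟩ are nonnegative, and for every configuration x one has ∑_{y∈X^N} ⟨y|M|x⟩ = 1. -/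
open Finset

theorem cb_nonneg' {N L : ℕ} (E : (Fin N → ZMod L) → ℝ) (β : ℝ)
    (x : Fin N → ZMod L) (i : Fin N) (d : Bool) : 0 ≤ cb E β x i d := by
  unfold cb; positivity

theorem cb_le' {N L : ℕ} (hN : 2 ≤ N) (E : (Fin N → ZMod L) → ℝ) (β : ℝ)
    (x : Fin N → ZMod L) (i : Fin N) (d : Bool) : cb E β x i d ≤ 1 / (2 * (N : ℝ)) := by
  unfold cb
  have h : (0 : ℝ) < N := by exact_mod_cast (by omega : 0 < N)
  apply one_div_le_one_div_of_le (by positivity)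
  have := Real.exp_pos (β * (E (hop x i d) - E x))
  nlinarith

theorem cb_sum_le' {N L : ℕ} (hN : 2 ≤ N) (E : (Fin N → ZMod L) → ℝ) (β : ℝ)
    (x : Fin N → ZMod L) : ∑ i : Fin N, ∑ d : Bool, cb E β x i d ≤ 1 := by
  have h : (0 : ℝ) < N := by exact_mod_cast (by omega : 0 < N)
  calc ∑ i : Fin N, ∑ d : Bool, cb E β x i d
      ≤ ∑ i : Fin N, ∑ d : Bool, 1 / (2 * (N : ℝ)) :=
        Finset.sum_le_sum fun i _ => Finset.sum_le_sum fun d _ => cb_le' hN E β x i d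
    _ = 1 := by
        simp only [Finset.sum_const, Finset.card_univ, Fintype.card_fin, Fintype.card_bool,
          nsmul_eq_mul]
        push_cast
        field_simp

theorem Tterm_sum' {N L : ℕ} (E : (Fin N → ZMod L) → ℝ) (β p : ℝ) (A : Finset ℕ)
    (y x : Fin N → ZMod L) :
    ∑ n ∈ A, Tterm E β p n y x = ∑ i : Fin N, ∑ d : Bool,
      if nS x i d ∈ A then
        p * cb E β x i d / (2 * (1 + (nS x i d : ℝ) * p)) *
          ∑ j ∈ Sset x i d, ∑ d' : Bool,
            ((if y = hop (hop x i d) j d' then (1 : ℝ) else 0)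
              - (if y = hop x i d then 1 else 0))
      else 0 := by
  unfold Tterm
  rw [Finset.sum_comm]
  refine Finset.sum_congr rfl fun i _ => ?_
  rw [Finset.sum_comm]
  refine Finset.sum_congr rfl fun d _ => ?_
  rw [Finset.sum_ite_eq]

theorem term_nonneg' {N L : ℕ} (E : (Fin N → ZMod L) → ℝ) (β p : ℝ) (hp : 0 ≤ p)
    (A : Finset ℕ) (y x : Fin N → ZMod L) (i : Fin N) (d : Bool) :
    0 ≤ cb E β x i d * (if y = hop x i d then (1 : ℝ) else 0) +
      (if nS x i d ∈ A then
        p * cb E β x i d / (2 * (1 + (nS x i d : ℝ) * p)) *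
          ∑ j ∈ Sset x i d, ∑ d' : Bool,
            ((if y = hop (hop x i d) j d' then (1 : ℝ) else 0)
              - (if y = hop x i d then 1 else 0))
      else 0) := by
  have hc := cb_nonneg' E β x i d
  have hh : (0 : ℝ) ≤ (if y = hop x i d then (1 : ℝ) else 0) := by split_ifs <;> norm_num
  generalize (if y = hop x i d then (1 : ℝ) else 0) = h at *
  by_cases hA : nS x i d ∈ A
  swap
  · rw [if_neg hA]
    positivity
  · rw [if_pos hA]
    simp only [Finset.sum_sub_distrib, Finset.sum_const, Finset.card_univ, Fintype.card_bool,
      nsmul_eq_mul]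
    have hs : (0 : ℝ) ≤ ∑ j ∈ Sset x i d, ∑ d' : Bool,
        (if y = hop (hop x i d) j d' then (1 : ℝ) else 0) :=
      Finset.sum_nonneg fun j _ => Finset.sum_nonneg fun d' _ => by split_ifs <;> norm_num
    generalize (∑ j ∈ Sset x i d, ∑ d' : Bool,
        (if y = hop (hop x i d) j d' then (1 : ℝ) else 0)) = s at *
    change 0 ≤ cb E β x i d * h + p * cb E β x i d / (2 * (1 + (nS x i d : ℝ) * p)) *
      (s - (nS x i d : ℝ) * (((2 : ℕ) : ℝ) * h))
    generalize cb E β x i d = c at *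
    have hn : (0 : ℝ) ≤ (nS x i d : ℝ) := Nat.cast_nonneg _
    generalize (nS x i d : ℝ) = n at *
    have hpos : 0 < 1 + n * p := by positivity
    have : c * h + p * c / (2 * (1 + n * p)) * (s - n * (((2 : ℕ) : ℝ) * h))
        = (c * h + p * c * s / 2) / (1 + n * p) := by
      push_cast
      field_simp
      ring
    rw [this]
    positivity

/-- For every `p ≥ 0` and every subset `A ⊆ {1,…,N−1}`, the matrix
`M = T₀ + ∑_{n∈A} T_n` is stochastic: entries are nonnegative and columns sum to 1. -/
theorem rank_supplanting_partial_sum_stochastic (N L : ℕ) (hN : 2 ≤ N) (hL : 3 ≤ L)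
    [NeZero L] (E : (Fin N → ZMod L) → ℝ)
    (hE : ∀ (σ : Equiv.Perm (Fin N)) (x : Fin N → ZMod L), E (x ∘ σ) = E x)
    (β p : ℝ) (hp : 0 ≤ p) (A : Finset ℕ) (hA : A ⊆ Finset.Icc 1 (N - 1)) :
    (∀ x y : Fin N → ZMod L,
        0 ≤ T0 E β y x + ∑ n ∈ A, Tterm E β p n y x)
    ∧ (∀ x : Fin N → ZMod L,
        ∑ y : Fin N → ZMod L, (T0 E β y x + ∑ n ∈ A, Tterm E β p n y x) = 1) := by
  refine ⟨fun x y => ?_, fun x => ?_⟩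
  · rw [Tterm_sum']
    unfold T0
    rw [add_right_comm, ← Finset.sum_add_distrib]
    refine add_nonneg (Finset.sum_nonneg fun i _ => ?_) (mul_nonneg ?_ ?_)
    · rw [← Finset.sum_add_distrib]
      exact Finset.sum_nonneg fun d _ => term_nonneg' E β p hp A y x i d
    · have := cb_sum_le' hN E β x
      linarith
    · split_ifs <;> norm_num
  · rw [Finset.sum_add_distrib]
    have h1 : ∑ y : Fin N → ZMod L, T0 E β y x = 1 := by
      unfold T0
      rw [Finset.sum_add_distrib, Finset.sum_comm, ← Finset.mul_sum]
      have : ∀ i : Fin N, ∑ y : Fin N → ZMod L, ∑ d : Bool,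
          cb E β x i d * (if y = hop x i d then (1 : ℝ) else 0) = ∑ d : Bool, cb E β x i d := by
        intro i
        rw [Finset.sum_comm]
        refine Finset.sum_congr rfl fun d _ => ?_
        rw [← Finset.mul_sum, Finset.sum_ite_eq']
        simp
      simp only [this, Finset.sum_ite_eq', Finset.mem_univ, if_true]
      ring
    have h2 : ∑ y : Fin N → ZMod L, ∑ n ∈ A, Tterm E β p n y x = 0 := by
      rw [Finset.sum_comm]
      refine Finset.sum_eq_zero fun n _ => ?_
      unfold Tterm
      rw [Finset.sum_comm]
      refine Finset.sum_eq_zero fun i _ => ?_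
      rw [Finset.sum_comm]
      refine Finset.sum_eq_zero fun d _ => ?_
      split_ifs
      · rw [← Finset.mul_sum, Finset.sum_comm]
        refine mul_eq_zero_of_right _ (Finset.sum_eq_zero fun j _ => ?_)
        rw [Finset.sum_comm]
        refine Finset.sum_eq_zero fun d' _ => ?_
        rw [Finset.sum_sub_distrib, Finset.sum_ite_eq', Finset.sum_ite_eq']
        simp
      · simp
    rw [h1, h2, add_zero]
end
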